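/- The set S_∞ = {y ∈ [0, 2/3] : L(y) is infinite} is residual in [0, 2/3], i.e. its complement {y ∈ [0, 2/3] : L(y) is finite} is meager. Moreover, S_∞ is the union of a G_δ set and a countable set. -/

import Mathlib

open Set MeasureTheory ENNReal

/-- `phi x` is the distance from `x` to the nearest integer. -/
noncomputable def phi (x : ℝ) : ℝ := |x - (round x : ℤ)|

/-- The Takagi function. -/
noncomputable def T (x : ℝ) : ℝ := ∑' n : ℕ, phi (2 ^ n * x) / 2 ^ n

/-- The `n`-th binary digit of `x` (terminating expansion for dyadic rationals). -/
noncomputable def eps (n : ℕ) (x : ℝ) : ℤ := ⌊2 ^ n * x⌋ - 2 * ⌊2 ^ (n - 1) * x⌋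

/-- `D k x = ∑_{j=1}^k (-1)^{ε_j(x)}`, the excess of 0 digits over 1 digits. -/
noncomputable def D (k : ℕ) (x : ℝ) : ℤ := ∑ j ∈ Finset.Icc 1 k, (1 - 2 * eps j x)

/-- The level set of the Takagi function at level `y`. -/
def L (y : ℝ) : Set ℝ := {x | x ∈ Set.Icc (0:ℝ) 1 ∧ T x = y}

/-- `x` is a balanced dyadic rational of order `m`. -/
def BalancedOfOrder (x : ℝ) (m : ℕ) : Prop :=
  x ∈ Set.Ico (0:ℝ) 1 ∧ (∃ k : ℤ, x = (k : ℝ) / 2 ^ (2 * m)) ∧ D (2 * m) x = 0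

/-- The generation of a balanced dyadic rational of order `m`:
the number of indices `1 ≤ j ≤ 2m` with `D j x = 0`. -/
noncomputable def generation (x : ℝ) (m : ℕ) : ℕ :=
  ((Finset.Icc 1 (2 * m)).filter (fun j => D j x = 0)).card

/-- A balanced dyadic rational of order `m` is leading if `D j x ≥ 0` for all `1 ≤ j ≤ 2m`. -/
def Leading (x : ℝ) (m : ℕ) : Prop := ∀ j ∈ Finset.Icc 1 (2 * m), 0 ≤ D j x

/-- The equivalence relation whose classes are the local level sets. -/
def locSetoid : Setoid ℝ where
  r x x' := ∀ n : ℕ, 1 ≤ n → |D n x| = |D n x'|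
  iseqv := ⟨fun _ _ _ => rfl, fun h n hn => (h n hn).symm,
    fun h g n hn => (h n hn).trans (g n hn)⟩

/-- The set of local level sets contained in `L y`: the image of `L y ∩ [0,1)`
under the quotient map of `locSetoid`. -/
def locClasses (y : ℝ) : Set (Quotient locSetoid) :=
  Quotient.mk locSetoid '' (L y ∩ Set.Ico (0:ℝ) 1)

theorem phi_nonneg (x : ℝ) : 0 ≤ phi x := abs_nonneg _

theorem phi_le_half (x : ℝ) : phi x ≤ 1 / 2 := abs_sub_round x

theorem phi_le_abs_sub (x : ℝ) (z : ℤ) : phi x ≤ |x - z| := round_le x z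

theorem phi_sub_phi_le (x y : ℝ) : phi x - phi y ≤ |x - y| := by
  have h := phi_le_abs_sub x (round y)
  have h' := abs_sub_le x y (round y : ℤ)
  have h'' : phi y = |y - (round y : ℤ)| := rfl
  linarith

theorem continuous_phi : Continuous phi := by
  refine (LipschitzWith.of_dist_le_mul (K := 1) fun x y => ?_).continuous
  rw [Real.dist_eq, Real.dist_eq, NNReal.coe_one, one_mul, abs_le]
  have h := phi_sub_phi_le y x
  rw [abs_sub_comm] at h
  exact ⟨by linarith, phi_sub_phi_le x y⟩

theorem phi_intCast (z : ℤ) : phi z = 0 := by simp [phi]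

theorem phi_intCast_add (z : ℤ) (x : ℝ) : phi (z + x) = phi x := by
  simp [phi]

theorem abs_le_phi {x : ℝ} (hx : |x| ≤ 1 / 2) : |x| ≤ phi x := by
  rw [phi]
  by_cases h : round x = 0
  · simp [h]
  · have h1 : (1 : ℝ) ≤ |((round x : ℤ) : ℝ)| := by exact_mod_cast Int.one_le_abs h
    have h2 := abs_sub_abs_le_abs_sub ((round x : ℤ) : ℝ) x
    rw [abs_sub_comm] at h2
    linarith

theorem takagi_term_le (x : ℝ) (n : ℕ) : phi (2 ^ n * x) / 2 ^ n ≤ 1 / 2 * (1 / 2) ^ n := by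
  rw [div_pow, one_pow, mul_one_div]
  gcongr
  exact phi_le_half _

theorem summable_half_geometric : Summable fun n : ℕ => (1 / 2 : ℝ) * (1 / 2) ^ n :=
  summable_geometric_two.mul_left _

theorem summable_takagi (x : ℝ) : Summable fun n : ℕ => phi (2 ^ n * x) / 2 ^ n :=
  Summable.of_nonneg_of_le (fun n => div_nonneg (phi_nonneg _) (by positivity))
    (takagi_term_le x) summable_half_geometric

theorem continuous_T : Continuous T := by
  refine continuous_tsum (fun n => ?_) summable_half_geometric fun n x => ?_
  · exact (continuous_phi.comp (continuous_const.mul continuous_id)).div_const _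
  · rw [Real.norm_of_nonneg (div_nonneg (phi_nonneg _) (by positivity))]
    exact takagi_term_le x n

theorem T_zero : T 0 = 0 := by
  have h : phi 0 = 0 := by simpa using phi_intCast 0
  simp [T, h]

theorem phi_two_pow_div_three (n : ℕ) : phi (2 ^ n * (1 / 3)) = 1 / 3 := by
  have hmod : (2 : ℤ) ^ n % 3 = 1 ∨ (2 : ℤ) ^ n % 3 = 2 := by
    induction n with
    | zero => simp
    | succ n ih => rw [pow_succ]; omega
  have key : ∃ z : ℤ, (2 : ℤ) ^ n = 3 * z + 1 ∨ (2 : ℤ) ^ n = 3 * z - 1 := by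
    rcases hmod with h | h
    · exact ⟨2 ^ n / 3, Or.inl (by omega)⟩
    · exact ⟨2 ^ n / 3 + 1, Or.inr (by omega)⟩
  have hle (x : ℝ) (hx : |x| = 1 / 3) : phi x = 1 / 3 := by
    apply le_antisymm
    · simpa [hx] using phi_le_abs_sub x 0
    · rw [← hx]; exact abs_le_phi (by rw [hx]; norm_num)
  obtain ⟨z, h | h⟩ := key
  · have h' : (2 : ℝ) ^ n = 3 * z + 1 := by exact_mod_cast h
    rw [show (2 : ℝ) ^ n * (1 / 3) = z + 1 / 3 by rw [h']; ring, phi_intCast_add]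
    exact hle _ (by norm_num)
  · have h' : (2 : ℝ) ^ n = 3 * z - 1 := by exact_mod_cast h
    rw [show (2 : ℝ) ^ n * (1 / 3) = z + -(1 / 3) by rw [h']; ring, phi_intCast_add]
    exact hle _ (by norm_num)

theorem T_one_third : T (1 / 3) = 2 / 3 := by
  have h (n : ℕ) : phi (2 ^ n * (1 / 3)) / 2 ^ n = 1 / 3 * (1 / 2) ^ n := by
    rw [phi_two_pow_div_three, div_pow, one_pow, mul_one_div]
  rw [T, tsum_congr h, tsum_mul_left, tsum_geometric_two]
  norm_num

theorem Icc_subset_image_T : Icc (0 : ℝ) (2 / 3) ⊆ T '' Icc 0 1 := by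
  have h := intermediate_value_Icc (by norm_num : (0 : ℝ) ≤ 1 / 3) continuous_T.continuousOn
  rw [T_zero, T_one_third] at h
  exact h.trans (image_mono (Icc_subset_Icc_right (by norm_num)))

/-- The Takagi function increases when moving away from a dyadic rational by a small power
of two, in either direction. -/
theorem T_dyadic_lt (k : ℤ) {N M : ℕ} (hNM : N < M) {h : ℝ} (hh : |h| = 1 / 2 ^ (N + M)) :
    T (k / 2 ^ N) < T (k / 2 ^ N + h) := by
  set x : ℝ := k / 2 ^ N with hx
  set g : ℕ → ℝ := fun n => phi (2 ^ n * (x + h)) / 2 ^ n - phi (2 ^ n * x) / 2 ^ n with hg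
  have hhpos : 0 < |h| := by rw [hh]; positivity
  have hsum : Summable g := (summable_takagi _).sub (summable_takagi _)
  have hT : T (x + h) - T x = ∑' n, g n :=
    ((summable_takagi (x + h)).tsum_sub (summable_takagi x)).symm
  have htail (i : ℕ) : g (N + i) = phi (2 ^ (N + i) * h) / 2 ^ (N + i) := by
    have hint : (2 : ℝ) ^ (N + i) * x = ((2 ^ i * k : ℤ) : ℝ) := by
      rw [hx, pow_add]; push_cast; field_simp
    simp only [hg]
    rw [mul_add, hint, phi_intCast_add, phi_intCast, zero_div, sub_zero]
  have hlow (n : ℕ) : -|h| ≤ g n := by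
    have h1 := phi_sub_phi_le (2 ^ n * x) (2 ^ n * (x + h))
    rw [show (2 : ℝ) ^ n * x - 2 ^ n * (x + h) = -(2 ^ n * h) by ring, abs_neg, abs_mul,
      abs_of_pos (by positivity : (0 : ℝ) < 2 ^ n)] at h1
    simp only [hg]
    rw [← sub_div, le_div_iff₀ (by positivity)]
    linarith
  have hmid (i : ℕ) (hi : i < M) : |h| ≤ g (N + i) := by
    have habs : |2 ^ (N + i) * h| = 2 ^ (N + i) * |h| := by
      rw [abs_mul, abs_of_pos (by positivity : (0 : ℝ) < 2 ^ (N + i))]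
    have hsmall : |2 ^ (N + i) * h| ≤ 1 / 2 := by
      rw [habs, hh, mul_one_div, div_le_div_iff₀ (by positivity) (by norm_num), one_mul,
        ← pow_succ]
      exact pow_le_pow_right₀ (by norm_num) (by omega)
    have h1 := abs_le_phi hsmall
    rw [htail, le_div_iff₀ (by positivity)]
    linarith
  have hpos : 0 < ∑ n ∈ Finset.range (N + M), g n := by
    rw [Finset.sum_range_add]
    have h1 : -(N * |h|) ≤ ∑ n ∈ Finset.range N, g n := by
      have := Finset.card_nsmul_le_sum (Finset.range N) g (-|h|) fun n _ => hlow n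
      simpa using this
    have h2 : M * |h| ≤ ∑ i ∈ Finset.range M, g (N + i) := by
      have := Finset.card_nsmul_le_sum (Finset.range M) (fun i => g (N + i)) |h|
        fun i hi => hmid i (Finset.mem_range.1 hi)
      simpa using this
    have h3 : (N : ℝ) * |h| < M * |h| := by gcongr
    linarith
  have hle : ∑ n ∈ Finset.range (N + M), g n ≤ ∑' n, g n := by
    refine hsum.sum_le_tsum _ fun n hn => ?_
    rw [Finset.mem_range, not_lt] at hn
    obtain ⟨i, rfl⟩ := Nat.exists_eq_add_of_le ((Nat.le_add_right N M).trans hn)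
    rw [htail]
    exact div_nonneg (phi_nonneg _) (by positivity)
  linarith

/-- Every open interval contains an interior peak of the Takagi function. -/
theorem exists_T_peak {u v : ℝ} (huv : u < v) :
    ∃ a d b, u < a ∧ a < d ∧ d < b ∧ b < v ∧ T a < T d ∧ T b < T d := by
  obtain ⟨N, hN⟩ := pow_unbounded_of_one_lt (2 / (v - u)) (by norm_num : (1 : ℝ) < 2)
  have hvu : 0 < v - u := sub_pos.2 huv
  rw [div_lt_iff₀ hvu] at hN
  set k : ℤ := ⌊2 ^ N * u⌋ + 1 with hk
  have hk1 : 2 ^ N * u < k := by rw [hk]; push_cast; exact Int.lt_floor_add_one _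
  have hk2 : (k : ℝ) ≤ 2 ^ N * u + 1 := by
    rw [hk]; push_cast; linarith [Int.floor_le (2 ^ N * u)]
  have hP : (0 : ℝ) < 2 ^ N := by positivity
  set δ : ℝ := 1 / 2 ^ (N + (N + 1)) with hδ
  have hδ0 : 0 < δ := by positivity
  have hδ1 : δ ≤ 1 / 2 ^ N :=
    one_div_le_one_div_of_le hP (pow_le_pow_right₀ (by norm_num) (by omega))
  have hx : ((k + 1 : ℤ) : ℝ) / 2 ^ N = k / 2 ^ N + 1 / 2 ^ N := by push_cast; ring
  have hua : u < k / 2 ^ N := by rw [lt_div_iff₀ hP]; linarith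
  have hbv : ((k + 1 : ℤ) : ℝ) / 2 ^ N < v := by
    rw [div_lt_iff₀ hP]; push_cast; nlinarith
  have hleft := T_dyadic_lt k (Nat.lt_succ_self N) (h := δ) (abs_of_pos hδ0)
  have hright := T_dyadic_lt (k + 1) (Nat.lt_succ_self N) (h := -δ)
    (by rw [abs_neg]; exact abs_of_pos hδ0)
  set a : ℝ := k / 2 ^ N
  set b : ℝ := ((k + 1 : ℤ) : ℝ) / 2 ^ N
  obtain ⟨d, hd, hmax⟩ := isCompact_Icc.exists_isMaxOn (s := Icc a b)
    ⟨a, ⟨le_rfl, by linarith⟩⟩ continuous_T.continuousOn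
  have had : T a < T d := hleft.trans_le (hmax ⟨by linarith, by linarith⟩)
  have hbd : T b < T d := hright.trans_le (hmax ⟨by linarith, by linarith⟩)
  refine ⟨a, d, b, hua, lt_of_le_of_ne hd.1 ?_, lt_of_le_of_ne hd.2 ?_, hbv, had, hbd⟩
  · rintro h; rw [h] at had; exact lt_irrefl _ had
  · rintro h; rw [h] at hbd; exact lt_irrefl _ hbd

/-- Among the values taken by the Takagi function on an interval, those taken at least `n` times
contain a dense open set. -/
theorem exists_open_le_encard (n : ℕ) : ∀ {u v : ℝ}, u < v → ∀ {V : Set ℝ}, IsOpen V →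
    V.Nonempty → V ⊆ T '' Icc u v → ∃ W ⊆ V, IsOpen W ∧ W.Nonempty ∧
      ∀ y ∈ W, (n : ℕ∞) ≤ {x | x ∈ Icc u v ∧ T x = y}.encard := by
  induction n with
  | zero => intro u v _ V hV hne _; exact ⟨V, Subset.rfl, hV, hne, by simp⟩
  | succ n ih =>
    intro u v huv V hV hne hsub
    obtain ⟨y, hy⟩ := hne
    obtain ⟨x, hx, rfl⟩ := hsub hy
    have hopen : IsOpen (T ⁻¹' V) := hV.preimage continuous_T
    rw [← closure_Ioo huv.ne] at hx
    obtain ⟨z, hzV, hz⟩ := mem_closure_iff.1 hx _ hopen hy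
    obtain ⟨p, q, hzpq, hpq⟩ := mem_nhds_iff_exists_Ioo_subset.1
      ((hopen.inter isOpen_Ioo).mem_nhds ⟨hzV, hz⟩)
    obtain ⟨a, d, b, hpa, had, hdb, hbq, hTad, hTbd⟩ := exists_T_peak (hzpq.1.trans hzpq.2)
    have hIcc : Icc a b ⊆ T ⁻¹' V ∩ Ioo u v :=
      fun t ht => hpq ⟨hpa.trans_le ht.1, ht.2.trans_lt hbq⟩
    have hW₁ : Ioo (max (T a) (T b)) (T d) ⊆ T '' Icc a d := fun y hy =>
      intermediate_value_Icc had.le continuous_T.continuousOn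
        ⟨(le_max_left _ _).trans hy.1.le, hy.2.le⟩
    have hW₂ : Ioo (max (T a) (T b)) (T d) ⊆ T '' Icc d b := fun y hy =>
      intermediate_value_Icc' hdb.le continuous_T.continuousOn
        ⟨(le_max_right _ _).trans hy.1.le, hy.2.le⟩
    obtain ⟨W, hWsub, hWo, hWne, hW⟩ :=
      ih had isOpen_Ioo (nonempty_Ioo.2 (max_lt hTad hTbd)) hW₁
    refine ⟨W, fun y hy => ?_, hWo, hWne, fun y hy => ?_⟩
    · obtain ⟨t, ht, rfl⟩ := hW₁ (hWsub hy)
      exact (hIcc ⟨ht.1, ht.2.trans hdb.le⟩).1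
    · obtain ⟨t, ht, rfl⟩ := hW₂ (hWsub hy)
      have hdt : d < t := lt_of_le_of_ne ht.1 <| by
        rintro rfl; exact lt_irrefl _ (hWsub hy).2
      have hnot : t ∉ {x | x ∈ Icc a d ∧ T x = T t} := fun h => hdt.not_ge h.1.2
      have hins : insert t {x | x ∈ Icc a d ∧ T x = T t} ⊆ {x | x ∈ Icc u v ∧ T x = T t} := by
        rintro s (rfl | hs)
        · exact ⟨Ioo_subset_Icc_self (hIcc ⟨had.le.trans ht.1, ht.2⟩).2, rfl⟩
        · exact ⟨Ioo_subset_Icc_self (hIcc ⟨hs.1.1, hs.1.2.trans hdb.le⟩).2, hs.2⟩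
      calc ((n + 1 : ℕ) : ℕ∞) ≤ {x | x ∈ Icc a d ∧ T x = T t}.encard + 1 := by
            push_cast; gcongr; exact hW _ hy
        _ = (insert t {x | x ∈ Icc a d ∧ T x = T t}).encard := (encard_insert_of_notMem hnot).symm
        _ ≤ _ := encard_le_encard hins

theorem isNowhereDense_encard_lt (n : ℕ) :
    IsNowhereDense {y : ℝ | y ∈ Icc (0 : ℝ) (2 / 3) ∧ (L y).encard < n} := by
  set A := {y : ℝ | y ∈ Icc (0 : ℝ) (2 / 3) ∧ (L y).encard < n}
  rw [IsNowhereDense, ← not_nonempty_iff_eq_empty]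
  rintro ⟨y, hy⟩
  obtain ⟨y₁, hy₁, hy₁A⟩ :=
    mem_closure_iff.1 (interior_subset hy) _ isOpen_interior hy
  have hcl : y₁ ∈ closure (Ioo (0 : ℝ) (2 / 3)) := by
    rw [closure_Ioo (by norm_num)]; exact hy₁A.1
  obtain ⟨y₂, hy₂⟩ := mem_closure_iff.1 hcl _ isOpen_interior hy₁
  obtain ⟨W, hWsub, hWo, ⟨w, hw⟩, hW⟩ := exists_open_le_encard n (zero_lt_one' ℝ)
    (isOpen_interior.inter isOpen_Ioo) ⟨y₂, hy₂⟩
    (fun t ht => Icc_subset_image_T (Ioo_subset_Icc_self ht.2))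
  obtain ⟨w', hw', hw'A⟩ := mem_closure_iff.1 (interior_subset (hWsub hw).1) _ hWo hw
  exact (hW w' hw').not_gt hw'A.2

theorem isMeagre_finite_level :
    IsMeagre {y : ℝ | y ∈ Icc (0 : ℝ) (2 / 3) ∧ (L y).Finite} := by
  refine (isMeagre_iUnion fun n : ℕ => (isNowhereDense_encard_lt n).isMeagre).mono ?_
  rintro y ⟨hy, hfin⟩
  obtain ⟨n, hn⟩ := ENat.ne_top_iff_exists.1 hfin.encard_lt_top.ne
  refine mem_iUnion.2 ⟨n + 1, hy, ?_⟩
  rw [← hn]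
  exact_mod_cast Nat.lt_succ_self n

theorem Set.OrdConnected.countable_diff_interior {A : Set ℝ} (hA : A.OrdConnected) :
    (A \ interior A).Countable := by
  have hsub : A \ interior A ⊆ {y | IsLeast A y} ∪ {y | IsGreatest A y} := by
    rintro y ⟨hy, hint⟩
    by_contra hcon
    simp only [mem_union, mem_ofPred_eq, IsLeast, IsGreatest, hy, true_and, not_or,
      mem_lowerBounds, mem_upperBounds, not_forall, not_le] at hcon
    obtain ⟨⟨a, ha, hay⟩, b, hb, hyb⟩ := hcon
    exact hint (mem_interior.2 ⟨Ioo a b, fun t ht =>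
      hA.out ha hb (Ioo_subset_Icc_self ht), isOpen_Ioo, hay, hyb⟩)
  refine Countable.mono hsub (Countable.union ?_ ?_)
  · exact Subsingleton.countable fun a ha b hb => IsLeast.unique ha hb
  · exact Subsingleton.countable fun a ha b hb => IsGreatest.unique ha hb

theorem countable_iUnion_diff_interior {ι : Type*} [Countable ι] {A : ι → Set ℝ}
    (hA : ∀ i, (A i).OrdConnected) : ((⋃ i, A i) \ interior (⋃ i, A i)).Countable := by
  refine (countable_iUnion fun i => (hA i).countable_diff_interior).mono ?_
  rintro y ⟨hy, hint⟩
  obtain ⟨i, hi⟩ := mem_iUnion.1 hy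
  exact mem_iUnion.2 ⟨i, hi, fun h => hint (interior_mono (subset_iUnion A i) h)⟩

/-- The part of `[0, 1]` lying in the `j`-th cell of the grid of mesh `1 / k`. -/
def gridCell (k : ℕ) (j : ℤ) : Set ℝ := {x | x ∈ Icc (0 : ℝ) 1 ∧ ⌊k * x⌋ = j}

theorem ordConnected_gridCell (k : ℕ) (j : ℤ) : (gridCell k j).OrdConnected := by
  refine ⟨fun a ha b hb t ht => ⟨⟨ha.1.1.trans ht.1, ht.2.trans hb.1.2⟩, le_antisymm ?_ ?_⟩⟩
  · rw [← hb.2]; exact Int.floor_mono (by gcongr; exact ht.2)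
  · rw [← ha.2]; exact Int.floor_mono (by gcongr; exact ht.1)

theorem ordConnected_image_gridCell (k : ℕ) (j : ℤ) : (T '' gridCell k j).OrdConnected :=
  ((ordConnected_gridCell k j).isPreconnected.image T continuous_T.continuousOn).ordConnected

theorem exists_injOn_floor (t : Finset ℝ) :
    ∃ k : ℕ, InjOn (fun x : ℝ => ⌊k * x⌋) (t : Set ℝ) := by
  have h : ∀ᶠ k : ℕ in Filter.atTop, ∀ x ∈ t, ∀ y ∈ t, x ≠ y → 1 ≤ k * |x - y| := by
    rw [Filter.eventually_all_finset]
    intro x _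
    rw [Filter.eventually_all_finset]
    intro y _
    by_cases hxy : x = y
    · simp [hxy]
    · have hpos : 0 < |x - y| := abs_pos.2 (sub_ne_zero.2 hxy)
      filter_upwards [(tendsto_natCast_atTop_atTop (R := ℝ)).eventually_ge_atTop (1 / |x - y|)]
        with k hk _
      rwa [div_le_iff₀ hpos] at hk
  obtain ⟨k, hk⟩ := h.exists
  refine ⟨k, fun x hx y hy hxy => ?_⟩
  by_contra hne
  have h1 := Int.abs_sub_lt_one_of_floor_eq_floor hxy
  rw [← mul_sub, abs_mul, Nat.abs_cast] at h1
  exact (hk x hx y hy hne).not_gt h1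

theorem le_encard_level_iff (n : ℕ) (y : ℝ) : (n : ℕ∞) ≤ (L y).encard ↔
    y ∈ ⋃ i : ℕ × {s : Finset ℤ // s.card = n}, ⋂ j ∈ i.2.1, T '' gridCell i.1 j := by
  simp only [mem_iUnion, mem_iInter]
  constructor
  · intro h
    obtain ⟨t, htL, ht⟩ := exists_subset_encard_eq h
    have htfin : t.Finite := finite_of_encard_eq_coe ht
    lift t to Finset ℝ using htfin
    rw [encard_coe_eq_coe_finsetCard, Nat.cast_inj] at ht
    obtain ⟨k, hk⟩ := exists_injOn_floor t
    refine ⟨⟨k, t.image fun x : ℝ => ⌊k * x⌋, by rw [Finset.card_image_of_injOn hk, ht]⟩, ?_⟩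
    intro j hj
    obtain ⟨x, hx, rfl⟩ := Finset.mem_image.1 hj
    exact ⟨x, ⟨(htL hx).1, rfl⟩, (htL hx).2⟩
  · rintro ⟨⟨k, s, rfl⟩, hs⟩
    choose! x hx hxy using hs
    have hinj : InjOn x (s : Set ℤ) := fun i hi j hj hij => by
      rw [← (hx i hi).2, hij, (hx j hj).2]
    rw [← encard_coe_eq_coe_finsetCard, ← hinj.encard_image]
    refine encard_le_encard ?_
    rintro _ ⟨j, hj, rfl⟩
    exact ⟨(hx j hj).1, hxy j hj⟩

theorem countable_le_encard_diff_interior (n : ℕ) :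
    ({y | (n : ℕ∞) ≤ (L y).encard} \ interior {y | (n : ℕ∞) ≤ (L y).encard}).Countable := by
  simp only [le_encard_level_iff, ofPred_mem_eq]
  exact countable_iUnion_diff_interior fun i =>
    ordConnected_biInter fun j _ => ordConnected_image_gridCell i.1 j

theorem infinite_level_iff (y : ℝ) : (L y).Infinite ↔ ∀ n : ℕ, (n : ℕ∞) ≤ (L y).encard := by
  rw [← encard_eq_top_iff, ENat.eq_top_iff_forall_ge]

theorem stmt11 :
    IsMeagre {y : ℝ | y ∈ Set.Icc (0:ℝ) (2/3) ∧ (L y).Finite} ∧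
    ∃ G C : Set ℝ, IsGδ G ∧ C.Countable ∧
      {y : ℝ | y ∈ Set.Icc (0:ℝ) (2/3) ∧ (L y).Infinite} = G ∪ C := by
  refine ⟨isMeagre_finite_level, ?_⟩
  set A : ℕ → Set ℝ := fun n => {y | (n : ℕ∞) ≤ (L y).encard}
  set S : Set ℝ := {y : ℝ | y ∈ Set.Icc (0:ℝ) (2/3) ∧ (L y).Infinite}
  have hGS : Icc (0 : ℝ) (2 / 3) ∩ ⋂ n, interior (A n) ⊆ S := fun y hy =>
    ⟨hy.1, (infinite_level_iff y).2 fun n =>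
      interior_subset (s := A n) (mem_iInter.1 hy.2 n)⟩
  refine ⟨Icc (0 : ℝ) (2 / 3) ∩ ⋂ n, interior (A n), S \ (Icc (0 : ℝ) (2 / 3) ∩
    ⋂ n, interior (A n)), isClosed_Icc.isGδ.inter (.iInter_of_isOpen fun n => isOpen_interior),
    ?_, (union_sdiff_cancel hGS).symm⟩
  refine (countable_iUnion countable_le_encard_diff_interior).mono ?_
  rintro y ⟨⟨hy, hinf⟩, hnot⟩
  obtain ⟨n, hn⟩ : ∃ n, y ∉ interior (A n) := by
    by_contra! h
    exact hnot ⟨hy, mem_iInter.2 h⟩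
  exact mem_iUnion.2 ⟨n, (infinite_level_iff y).1 hinf n, hn⟩
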